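/- Let n,m ≥ 1 and 1 ≤ i ≤ n. For every ρ ∈ S_{n+m−1} one has B_i(P_i(ρ)) ≤ ρ ≤ T_i(P_i(ρ)) in the left weak order on S_{n+m−1}. -/

import Mathlib

open Equiv

/-- The one-line value (0-indexed) of a permutation of `Fin N`, extended to all of `ℕ`
by the identity.  Position `j` (0-indexed) carries the value `pv σ j` (0-indexed). -/
def pv {N : ℕ} (σ : Equiv.Perm (Fin N)) (j : ℕ) : ℕ :=
  if h : j < N then (σ ⟨j, h⟩ : ℕ) else j

/-- The left weak (Bruhat) order on `S_N`: inclusion of inversion sets, where the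
inversion set of `σ` is `{(p,q) | p < q ∧ σ p > σ q}`. -/
def wle {N : ℕ} (σ τ : Equiv.Perm (Fin N)) : Prop :=
  ∀ p q : Fin N, p < q → σ q < σ p → τ q < τ p

instance {N : ℕ} (σ τ : Equiv.Perm (Fin N)) : Decidable (wle σ τ) :=
  inferInstanceAs (Decidable (∀ p q : Fin N, p < q → σ q < σ p → τ q < τ p))

/-- The `a`-values of the insertion construction `B_i` (0-indexed values):
`avv m s x = x` if `x < s` and `x + m - 1` otherwise. -/
def avv (m s x : ℕ) : ℕ := if x < s then x else x + m - 1

/-- The one-line values of the permutation `B_i(σ,τ) ∈ S_{n+m-1}`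
(0-indexed position `i`, with `i < n`, and 0-indexed values). -/
def BFun {n m : ℕ} (i : ℕ) (σ : Equiv.Perm (Fin n)) (τ : Equiv.Perm (Fin m)) (j : ℕ) : ℕ :=
  if j < i then avv m (pv σ i) (pv σ j)
  else if j < i + m then pv τ (j - i) + pv σ i
  else avv m (pv σ i) (pv σ (j - m + 1))

/-- `ρ ∈ S_{n+m-1}` is the permutation `B_i(σ,τ)`. -/
def IsB {n m : ℕ} (i : ℕ) (σ : Equiv.Perm (Fin n)) (τ : Equiv.Perm (Fin m))
    (ρ : Equiv.Perm (Fin (n + m - 1))) : Prop :=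
  ∀ j : ℕ, j < n + m - 1 → pv ρ j = BFun i σ τ j

/-- The set of entries of the first block `L₁` of `B_i(σ,τ)` (positions `< i`, 0-indexed). -/
def bL1 {n m : ℕ} (i : ℕ) (σ : Equiv.Perm (Fin n)) (τ : Equiv.Perm (Fin m)) : Set ℕ :=
  BFun i σ τ '' {p | p < i}

/-- The set of entries of the third block `L₃` of `B_i(σ,τ)`
(positions in `[i+m, n+m-2]`, 0-indexed). -/
def bL3 {n m : ℕ} (i : ℕ) (σ : Equiv.Perm (Fin n)) (τ : Equiv.Perm (Fin m)) : Set ℕ :=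
  BFun i σ τ '' {p | i + m ≤ p ∧ p < n + m - 1}

/-- The number `k_σ`: the largest `j ≤ i` such that the interval `[σ_i - j, σ_i]`
(of actual integers, whence also `j ≤ σ_i`) is contained in `{L₁} ∪ {σ_i}`. -/
noncomputable def kpar {n m : ℕ} (i : ℕ) (σ : Equiv.Perm (Fin n)) (τ : Equiv.Perm (Fin m)) : ℕ :=
  sSup {j | j ≤ i ∧ j ≤ pv σ i ∧
    Set.Icc (pv σ i - j) (pv σ i) ⊆ insert (pv σ i) (bL1 i σ τ)}

/-- The number `l_σ`: the largest `j ≤ n - 1 - i` such that `[η, η + j] ⊆ {η} ∪ {L₃}`,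
where `η = σ_i + m - 1`. -/
noncomputable def lpar {n m : ℕ} (i : ℕ) (σ : Equiv.Perm (Fin n)) (τ : Equiv.Perm (Fin m)) : ℕ :=
  sSup {j | j ≤ n - 1 - i ∧
    Set.Icc (pv σ i + m - 1) (pv σ i + m - 1 + j) ⊆ insert (pv σ i + m - 1) (bL3 i σ τ)}

/-- `A_{1,b}`: the entries of `L₁` smaller than `σ_i - k_σ`. -/
noncomputable def A1b {n m : ℕ} (i : ℕ) (σ : Equiv.Perm (Fin n)) (τ : Equiv.Perm (Fin m)) :
    Set ℕ := {x ∈ bL1 i σ τ | x < pv σ i - kpar i σ τ}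

/-- `A_{1,t}`: the entries of `L₁` bigger than `σ_i`. -/
def A1t {n m : ℕ} (i : ℕ) (σ : Equiv.Perm (Fin n)) (τ : Equiv.Perm (Fin m)) : Set ℕ :=
  {x ∈ bL1 i σ τ | pv σ i < x}

/-- `A_{3,b}`: the entries of `L₃` smaller than `η = σ_i + m - 1`. -/
def A3b {n m : ℕ} (i : ℕ) (σ : Equiv.Perm (Fin n)) (τ : Equiv.Perm (Fin m)) : Set ℕ :=
  {x ∈ bL3 i σ τ | x < pv σ i + m - 1}

/-- `A_{3,t}`: the entries of `L₃` bigger than `η + l_σ`. -/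
noncomputable def A3t {n m : ℕ} (i : ℕ) (σ : Equiv.Perm (Fin n)) (τ : Equiv.Perm (Fin m)) :
    Set ℕ := {x ∈ bL3 i σ τ | pv σ i + m - 1 + lpar i σ τ < x}

/-- `ρ ∈ S_{n+m-1}` is the permutation `T_i(σ,τ)`:  for `m = 1` it is `σ` itself;
for `m ≥ 2` its three blocks standardize like those of `B_i(σ,τ)` and have the
prescribed entry sets. -/
noncomputable def IsT {n m : ℕ} (i : ℕ) (σ : Equiv.Perm (Fin n)) (τ : Equiv.Perm (Fin m))
    (ρ : Equiv.Perm (Fin (n + m - 1))) : Prop :=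
  if m = 1 then (∀ p : ℕ, pv ρ p = pv σ p)
  else
    (∀ p q : ℕ, p < i → q < i → (pv ρ p < pv ρ q ↔ BFun i σ τ p < BFun i σ τ q)) ∧
    (∀ p q : ℕ, i ≤ p → p < i + m → i ≤ q → q < i + m →
      (pv ρ p < pv ρ q ↔ BFun i σ τ p < BFun i σ τ q)) ∧
    (∀ p q : ℕ, i + m ≤ p → p < n + m - 1 → i + m ≤ q → q < n + m - 1 →
      (pv ρ p < pv ρ q ↔ BFun i σ τ p < BFun i σ τ q)) ∧
    pv ρ '' {p | p < i} =
      A1b i σ τ ∪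
        Set.Ico (pv σ i + m - 1 + lpar i σ τ - kpar i σ τ) (pv σ i + m - 1 + lpar i σ τ) ∪
        A1t i σ τ ∧
    pv ρ '' {p | i ≤ p ∧ p < i + m} =
      insert (pv σ i - kpar i σ τ) (insert (pv σ i + m - 1 + lpar i σ τ)
        (Set.Ioo (pv σ i - kpar i σ τ + lpar i σ τ)
          (pv σ i + m - 1 + lpar i σ τ - kpar i σ τ))) ∧
    pv ρ '' {p | i + m ≤ p ∧ p < n + m - 1} =
      A3b i σ τ ∪ Set.Ioc (pv σ i - kpar i σ τ) (pv σ i - kpar i σ τ + lpar i σ τ) ∪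
        A3t i σ τ

/-- `u^ρ`: the minimum of the entries of the middle block `L₂(ρ)` (positions `[i, i+m-1]`). -/
noncomputable def uPar {N : ℕ} (i m : ℕ) (ρ : Equiv.Perm (Fin N)) : ℕ :=
  sInf (pv ρ '' {p | i ≤ p ∧ p < i + m})

/-- `v^ρ`: the maximum of the entries of the middle block `L₂(ρ)`. -/
noncomputable def vPar {N : ℕ} (i m : ℕ) (ρ : Equiv.Perm (Fin N)) : ℕ :=
  sSup (pv ρ '' {p | i ≤ p ∧ p < i + m})

/-- `C_{1,m}^ρ`: the entries of the first block of `ρ` lying strictly between `u^ρ` and `v^ρ`. -/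
noncomputable def Cmid1 {N : ℕ} (i m : ℕ) (ρ : Equiv.Perm (Fin N)) : Set ℕ :=
  {x ∈ pv ρ '' {p | p < i} | uPar i m ρ < x ∧ x < vPar i m ρ}

/-- `C_{3,m}^ρ`: the entries of the third block of `ρ` lying strictly between `u^ρ` and `v^ρ`. -/
noncomputable def Cmid3 {N : ℕ} (i m : ℕ) (ρ : Equiv.Perm (Fin N)) : Set ℕ :=
  {x ∈ pv ρ '' {p | i + m ≤ p ∧ p < N} | uPar i m ρ < x ∧ x < vPar i m ρ}

/-- The sequence `(Bρ(1),…,Bρ(i-1), w, Bρ(i+m),…,Bρ(n+m-1))` of length `n`,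
used to produce the first component of `P_i(ρ)` by standardization (here `w = u + n₁`). -/
def concatFun {N : ℕ} (i m w : ℕ) (β : Equiv.Perm (Fin N)) (r : ℕ) : ℕ :=
  if r < i then pv β r else if r = i then w else pv β (r + m - 1)

/-- `P_i(ρ) = (σ,τ)`: for `m = 1` this means `σ = ρ` and `τ = id`; for `m ≥ 2` it is
expressed via the intermediate permutation `Bρ` (denoted `β`), whose blocks standardize
like those of `ρ` and have the prescribed entry sets, `σ` being the standardization of
`(β(1),…,β(i-1), u+n₁, β(i+m),…,β(n+m-1))` and `τ` the standardization of `L₂(ρ)`. -/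
noncomputable def IsP {n m : ℕ} (i : ℕ) (ρ : Equiv.Perm (Fin (n + m - 1)))
    (σ : Equiv.Perm (Fin n)) (τ : Equiv.Perm (Fin m)) : Prop :=
  if m = 1 then (∀ p : ℕ, pv σ p = pv ρ p) ∧ τ = 1
  else
    ∃ β : Equiv.Perm (Fin (n + m - 1)),
      (∀ p q : ℕ, p < i → q < i → (pv β p < pv β q ↔ pv ρ p < pv ρ q)) ∧
      (∀ p q : ℕ, i ≤ p → p < i + m → i ≤ q → q < i + m →
        (pv β p < pv β q ↔ pv ρ p < pv ρ q)) ∧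
      (∀ p q : ℕ, i + m ≤ p → p < n + m - 1 → i + m ≤ q → q < n + m - 1 →
        (pv β p < pv β q ↔ pv ρ p < pv ρ q)) ∧
      pv β '' {p | p < i} =
        {x ∈ pv ρ '' {p | p < i} | x < uPar i m ρ} ∪
          Set.Ico (uPar i m ρ) (uPar i m ρ + (Cmid1 i m ρ).ncard) ∪
          {x ∈ pv ρ '' {p | p < i} | vPar i m ρ < x} ∧
      pv β '' {p | i ≤ p ∧ p < i + m} =
        Set.Icc (uPar i m ρ + (Cmid1 i m ρ).ncard) (vPar i m ρ - (Cmid3 i m ρ).ncard) ∧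
      pv β '' {p | i + m ≤ p ∧ p < n + m - 1} =
        {x ∈ pv ρ '' {p | i + m ≤ p ∧ p < n + m - 1} | x < uPar i m ρ} ∪
          Set.Ioc (vPar i m ρ - (Cmid3 i m ρ).ncard) (vPar i m ρ) ∪
          {x ∈ pv ρ '' {p | i + m ≤ p ∧ p < n + m - 1} | vPar i m ρ < x} ∧
      (∀ p q : Fin n, σ p < σ q ↔
        concatFun i m (uPar i m ρ + (Cmid1 i m ρ).ncard) β p <
          concatFun i m (uPar i m ρ + (Cmid1 i m ρ).ncard) β q) ∧
      (∀ p q : Fin m, τ p < τ q ↔ pv ρ (i + p) < pv ρ (i + q))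

theorem pv_of_lt {N : ℕ} (σ : Equiv.Perm (Fin N)) {j : ℕ} (h : j < N) :
    pv σ j = (σ ⟨j, h⟩ : ℕ) := by
  simp [pv, h]

theorem pv_lt {N : ℕ} (σ : Equiv.Perm (Fin N)) {j : ℕ} (h : j < N) : pv σ j < N := by
  rw [pv_of_lt σ h]
  exact (σ ⟨j, h⟩).isLt

theorem exists_pv_eq {N : ℕ} (σ : Equiv.Perm (Fin N)) {x : ℕ} (h : x < N) :
    ∃ j < N, pv σ j = x :=
  ⟨σ.symm ⟨x, h⟩, (σ.symm ⟨x, h⟩).isLt, by simp [pv_of_lt σ (σ.symm ⟨x, h⟩).isLt]⟩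

theorem pv_injective {N : ℕ} (σ : Equiv.Perm (Fin N)) : Function.Injective (pv σ) := by
  intro a b h
  by_cases ha : a < N <;> by_cases hb : b < N
  · rw [pv_of_lt σ ha, pv_of_lt σ hb] at h
    simpa using σ.injective (Fin.ext h)
  · have := pv_lt σ ha
    simp only [pv, hb, dite_false] at h this
    omega
  · have := pv_lt σ hb
    simp only [pv, ha, dite_false] at h this
    omega
  · simpa [pv, ha, hb] using h

theorem wle_iff_pv {N : ℕ} (σ τ : Equiv.Perm (Fin N)) :
    wle σ τ ↔ ∀ p q : ℕ, p < q → q < N → pv σ q < pv σ p → pv τ q < pv τ p := by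
  constructor
  · intro h p q hpq hq hlt
    have hp : p < N := hpq.trans hq
    rw [pv_of_lt _ hp, pv_of_lt _ hq] at hlt ⊢
    exact h ⟨p, hp⟩ ⟨q, hq⟩ hpq hlt
  · intro h p q hpq hlt
    have := h p q hpq q.isLt
    simp only [pv_of_lt _ p.isLt, pv_of_lt _ q.isLt] at this
    exact this hlt

/-- Two functions inducing the same order on `P`, whose images agree below `t`, agree wherever
the first one is below `t`. -/
theorem eq_of_lt_of_image_agree {P : Set ℕ} {f g : ℕ → ℕ}
    (hfg : ∀ p ∈ P, ∀ q ∈ P, (f p < f q ↔ g p < g q)) {t : ℕ}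
    (him : ∀ x < t, (x ∈ f '' P ↔ x ∈ g '' P)) :
    ∀ p ∈ P, f p < t → g p = f p := by
  suffices H : ∀ x, x < t → ∀ p ∈ P, f p = x → g p = x from
    fun p hp hlt => H _ hlt p hp rfl
  intro x
  induction x using Nat.strong_induction_on with
  | _ x ih =>
    intro hx p hp hfp
    obtain ⟨q, hq, hgq⟩ := (him x hx).1 ⟨p, hp, hfp⟩
    rcases lt_trichotomy (g p) x with h | h | h
    · obtain ⟨r, hr, hfr⟩ := (him (g p) (h.trans hx)).2 ⟨p, hp, rfl⟩
      have h1 := ih (g p) h (h.trans hx) r hr hfr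
      have h2 := (hfg r hr p hp).1 (by omega)
      omega
    · exact h
    · have h1 := (hfg q hq p hp).2 (by omega)
      have h2 := ih (f q) (by omega) (by omega) q hq rfl
      omega

/-- Two bounded functions inducing the same order on `P`, whose images agree from `t` on, agree
wherever the first one is at least `t`. -/
theorem eq_of_le_of_image_agree {P : Set ℕ} {f g : ℕ → ℕ}
    (hfg : ∀ p ∈ P, ∀ q ∈ P, (f p < f q ↔ g p < g q)) {t M : ℕ}
    (hf : ∀ p ∈ P, f p < M) (hg : ∀ p ∈ P, g p < M)
    (him : ∀ x, t ≤ x → (x ∈ f '' P ↔ x ∈ g '' P)) :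
    ∀ p ∈ P, t ≤ f p → g p = f p := by
  intro p hp hle
  have key := eq_of_lt_of_image_agree (P := P) (f := fun p => M - 1 - f p)
    (g := fun p => M - 1 - g p) (t := M - t)
    (by
      intro a ha b hb
      have := hfg b hb a ha
      have := hf a ha
      have := hf b hb
      have := hg a ha
      have := hg b hb
      omega)
    (by
      intro x hx
      have h := him (M - 1 - x) (by omega)
      constructor
      · rintro ⟨a, ha, rfl⟩
        have := hf a ha
        obtain ⟨b, hb, hb'⟩ := h.1 ⟨a, ha, by dsimp only; omega⟩
        exact ⟨b, hb, by dsimp only at hb' ⊢; omega⟩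
      · rintro ⟨a, ha, rfl⟩
        have := hg a ha
        obtain ⟨b, hb, hb'⟩ := h.2 ⟨a, ha, by dsimp only; omega⟩
        exact ⟨b, hb, by dsimp only at hb' ⊢; omega⟩)
    p hp
    (by have := hf p hp; omega)
  have := hf p hp
  have := hg p hp
  omega

/-- If the middle block of `β` is an interval starting at `w`, the insertion `B_i` of the
standardized middle block into the standardized contraction of `β` gives `β` back. -/
theorem BFun_eq_of_standardization {n m i w : ℕ} (hm : 2 ≤ m) (hi : i < n)
    (β : Equiv.Perm (Fin (n + m - 1))) (σ : Equiv.Perm (Fin n)) (τ : Equiv.Perm (Fin m))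
    (hmid : pv β '' {p | i ≤ p ∧ p < i + m} = Set.Ico w (w + m))
    (hσ : ∀ p q : Fin n, σ p < σ q ↔ concatFun i m w β p < concatFun i m w β q)
    (hτ : ∀ p q : Fin m, τ p < τ q ↔ pv β (i + p) < pv β (i + q)) :
    pv σ i = w ∧ ∀ j < n + m - 1, BFun i σ τ j = pv β j := by
  have hmid' : ∀ p, i ≤ p → p < i + m → w ≤ pv β p ∧ pv β p < w + m := fun p h1 h2 =>
    hmid.subset ⟨p, ⟨h1, h2⟩, rfl⟩
  have hmid_iff : ∀ x, w ≤ x → x < w + m → ∃ p, (i ≤ p ∧ p < i + m) ∧ pv β p = x :=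
    fun x h1 h2 => hmid.superset ⟨h1, h2⟩
  have hnotmid : ∀ p, ¬ (i ≤ p ∧ p < i + m) → ¬ (w ≤ pv β p ∧ pv β p < w + m) := by
    intro p hp ⟨h1, h2⟩
    obtain ⟨q, hq, hqx⟩ := hmid_iff _ h1 h2
    exact hp (pv_injective β hqx ▸ hq)
  have hwN : w + m ≤ n + m - 1 := by
    obtain ⟨p, hp, hpx⟩ := hmid_iff (w + m - 1) (by omega) (by omega)
    have := pv_lt β (j := p) (by omega)
    omega
  have hstretch : ∀ r < n, (if pv σ r ≤ w then pv σ r else pv σ r + m - 1) =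
      concatFun i m w β r := by
    intro r hr
    refine eq_of_lt_of_image_agree (P := {p | p < n}) (f := concatFun i m w β)
      (g := fun r => if pv σ r ≤ w then pv σ r else pv σ r + m - 1) (t := n + m - 1)
      ?_ ?_ r hr ?_
    · intro p hp q hq
      have h := hσ ⟨p, hp⟩ ⟨q, hq⟩
      rw [Fin.lt_def, ← pv_of_lt σ hp, ← pv_of_lt σ hq] at h
      dsimp only at h ⊢
      rw [← h]
      split_ifs <;> omega
    · intro x hx
      have hc : x ∈ concatFun i m w β '' {p | p < n} ↔ (x ≤ w ∨ w + m ≤ x) := by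
        constructor
        · rintro ⟨r, hr, rfl⟩
          have hr' : r < n := hr
          unfold concatFun
          split_ifs with h1 h2
          · have := hnotmid r (by omega)
            omega
          · omega
          · have := hnotmid (r + m - 1) (by omega)
            omega
        · intro h
          rcases eq_or_ne x w with rfl | hne
          · exact ⟨i, hi, by simp [concatFun]⟩
          obtain ⟨j, hj, rfl⟩ := exists_pv_eq β hx
          by_cases h1 : j < i
          · exact ⟨j, h1.trans hi, by simp [concatFun, h1]⟩
          by_cases h2 : j < i + m
          · have := hmid' j (by omega) h2
            omega
          · refine ⟨j - m + 1, show j - m + 1 < n by omega, ?_⟩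
            unfold concatFun
            rw [if_neg (by omega), if_neg (by omega)]
            congr 1
            omega
      rw [hc]
      constructor
      · rintro (h | h)
        · obtain ⟨r, hr, hrx⟩ := exists_pv_eq σ (show x < n by omega)
          refine ⟨r, hr, ?_⟩
          dsimp only
          rw [if_pos (by omega), hrx]
        · obtain ⟨r, hr, hrx⟩ := exists_pv_eq σ (show x + 1 - m < n by omega)
          refine ⟨r, hr, ?_⟩
          dsimp only
          rw [if_neg (by omega), hrx]
          omega
      · rintro ⟨r, hr, rfl⟩
        dsimp only
        split_ifs <;> omega
    · unfold concatFun
      split_ifs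
      · exact pv_lt β (by omega)
      · omega
      · exact pv_lt β (by omega)
  have hσi : pv σ i = w := by
    have := hstretch i hi
    simp only [concatFun, lt_irrefl, if_false, if_true] at this
    split_ifs at this <;> omega
  have havv : ∀ r < n, r ≠ i → avv m w (pv σ r) = concatFun i m w β r := by
    intro r hr hri
    have h1 : pv σ r ≠ w := fun h => hri (pv_injective σ (h.trans hσi.symm))
    rw [← hstretch r hr]
    unfold avv
    split_ifs <;> omega
  refine ⟨hσi, fun j hj => ?_⟩
  unfold BFun
  rw [hσi]
  split_ifs with h1 h2
  · rw [havv j (by omega) (by omega)]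
    simp [concatFun, h1]
  · have key := eq_of_lt_of_image_agree (P := {p | p < m}) (f := fun p => pv β (i + p))
      (g := fun p => pv τ p + w) (t := n + m - 1)
      (by
        intro p hp q hq
        have h := hτ ⟨p, hp⟩ ⟨q, hq⟩
        rw [Fin.lt_def, ← pv_of_lt τ hp, ← pv_of_lt τ hq] at h
        dsimp only at h ⊢
        omega)
      (by
        intro x hx
        constructor
        · rintro ⟨p, hp, rfl⟩
          have hp' : p < m := hp
          have := hmid' (i + p) (by omega) (by omega)
          obtain ⟨r, hr, hrx⟩ := exists_pv_eq τ (show pv β (i + p) - w < m by omega)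
          exact ⟨r, hr, by dsimp only; omega⟩
        · rintro ⟨p, hp, rfl⟩
          have := pv_lt τ hp
          obtain ⟨r, hr, hrx⟩ := hmid_iff (pv τ p + w) (by omega) (by omega)
          refine ⟨r - i, show r - i < m by omega, ?_⟩
          dsimp only
          rw [← hrx]
          congr 1
          omega)
      (j - i) (show j - i < m by omega) (pv_lt β (by omega))
    rw [key]
    congr 1
    omega
  · rw [havv (j - m + 1) (by omega) (by omega)]
    unfold concatFun
    rw [if_neg (by omega), if_neg (by omega)]
    congr 1
    omega

theorem kpar_spec {n m : ℕ} (i : ℕ) (σ : Equiv.Perm (Fin n)) (τ : Equiv.Perm (Fin m)) :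
    kpar i σ τ ≤ pv σ i ∧
      ∀ x, pv σ i - kpar i σ τ ≤ x → x < pv σ i → x ∈ bL1 i σ τ := by
  have h : kpar i σ τ ∈ {j | j ≤ i ∧ j ≤ pv σ i ∧
      Set.Icc (pv σ i - j) (pv σ i) ⊆ insert (pv σ i) (bL1 i σ τ)} :=
    Nat.sSup_mem ⟨0, by simp⟩ ⟨i, fun j hj => hj.1⟩
  refine ⟨h.2.1, fun x h1 h2 => ?_⟩
  exact (h.2.2 ⟨h1, h2.le⟩).resolve_left h2.ne

theorem le_kpar {n m : ℕ} {i : ℕ} {σ : Equiv.Perm (Fin n)} {τ : Equiv.Perm (Fin m)} {j : ℕ}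
    (hji : j ≤ i) (hj : j ≤ pv σ i)
    (h : ∀ x, pv σ i - j ≤ x → x < pv σ i → x ∈ bL1 i σ τ) : j ≤ kpar i σ τ := by
  refine le_csSup ⟨i, fun j hj => hj.1⟩ ⟨hji, hj, fun x hx => ?_⟩
  rcases hx.2.eq_or_lt with h1 | h1
  · exact Or.inl h1
  · exact Or.inr (h x hx.1 h1)

theorem lpar_spec {n m : ℕ} (i : ℕ) (σ : Equiv.Perm (Fin n)) (τ : Equiv.Perm (Fin m)) :
    ∀ x, pv σ i + m - 1 < x → x ≤ pv σ i + m - 1 + lpar i σ τ → x ∈ bL3 i σ τ := by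
  have h : lpar i σ τ ∈ {j | j ≤ n - 1 - i ∧
      Set.Icc (pv σ i + m - 1) (pv σ i + m - 1 + j) ⊆
        insert (pv σ i + m - 1) (bL3 i σ τ)} :=
    Nat.sSup_mem ⟨0, by simp⟩ ⟨n - 1 - i, fun j hj => hj.1⟩
  exact fun x h1 h2 => (h.2 ⟨h1.le, h2⟩).resolve_left h1.ne'

theorem le_lpar {n m : ℕ} {i : ℕ} {σ : Equiv.Perm (Fin n)} {τ : Equiv.Perm (Fin m)} {j : ℕ}
    (hj : j ≤ n - 1 - i)
    (h : ∀ x, pv σ i + m - 1 < x → x ≤ pv σ i + m - 1 + j → x ∈ bL3 i σ τ) :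
    j ≤ lpar i σ τ := by
  refine le_csSup ⟨n - 1 - i, fun j hj => hj.1⟩ ⟨hj, fun x hx => ?_⟩
  rcases hx.1.eq_or_lt with h1 | h1
  · exact Or.inl h1.symm
  · exact Or.inr (h x h1 hx.2)

theorem ncard_Cmid1_le {N : ℕ} (i m : ℕ) (ρ : Equiv.Perm (Fin N)) :
    (Cmid1 i m ρ).ncard ≤ i := by
  have hfin : (Set.Iio i).Finite := Set.finite_Iio i
  calc (Cmid1 i m ρ).ncard ≤ (pv ρ '' Set.Iio i).ncard :=
        Set.ncard_le_ncard (fun x hx => hx.1) (hfin.image _)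
    _ ≤ (Set.Iio i).ncard := Set.ncard_image_le hfin
    _ = i := by simp

theorem ncard_Cmid3_le {N : ℕ} (i m : ℕ) (ρ : Equiv.Perm (Fin N)) :
    (Cmid3 i m ρ).ncard ≤ N - (i + m) := by
  have hfin : (Set.Ico (i + m) N).Finite := Set.finite_Ico _ _
  calc (Cmid3 i m ρ).ncard ≤ (pv ρ '' Set.Ico (i + m) N).ncard :=
        Set.ncard_le_ncard (fun x hx => hx.1) (hfin.image _)
    _ ≤ (Set.Ico (i + m) N).ncard := Set.ncard_image_le hfin
    _ = N - (i + m) := by simp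

theorem middle_block_extrema {N : ℕ} {i m : ℕ} (hm : 1 ≤ m) (ρ : Equiv.Perm (Fin N)) :
    (∀ p, i ≤ p → p < i + m → uPar i m ρ ≤ pv ρ p ∧ pv ρ p ≤ vPar i m ρ) ∧
      (∃ p, (i ≤ p ∧ p < i + m) ∧ pv ρ p = uPar i m ρ) ∧
      ∃ p, (i ≤ p ∧ p < i + m) ∧ pv ρ p = vPar i m ρ := by
  have hne : (pv ρ '' {p | i ≤ p ∧ p < i + m}).Nonempty := ⟨_, i, ⟨le_rfl, by omega⟩, rfl⟩
  have hbdd : BddAbove (pv ρ '' {p | i ≤ p ∧ p < i + m}) :=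
    ((Set.finite_Ico i (i + m)).image (pv ρ)).bddAbove
  refine ⟨fun p h1 h2 => ?_, Nat.sInf_mem hne, Nat.sSup_mem hne hbdd⟩
  exact ⟨Nat.sInf_le ⟨p, ⟨h1, h2⟩, rfl⟩, le_csSup hbdd ⟨p, ⟨h1, h2⟩, rfl⟩⟩

/-- Two bounded functions inducing the same order on `P`, whose images agree below `a` and from
`b` on, agree wherever one of them takes a value below `a` or at least `b`. -/
theorem eq_of_image_agree_outside {P : Set ℕ} {f g : ℕ → ℕ}
    (hfg : ∀ p ∈ P, ∀ q ∈ P, (f p < f q ↔ g p < g q)) {a b M : ℕ}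
    (hf : ∀ p ∈ P, f p < M) (hg : ∀ p ∈ P, g p < M)
    (hlow : ∀ x < a, (x ∈ f '' P ↔ x ∈ g '' P))
    (hhigh : ∀ x, b ≤ x → (x ∈ f '' P ↔ x ∈ g '' P)) :
    ∀ p ∈ P, (f p < a ∨ g p < a ∨ b ≤ f p ∨ b ≤ g p) → f p = g p := by
  have hgf : ∀ p ∈ P, ∀ q ∈ P, (g p < g q ↔ f p < f q) := fun p hp q hq => (hfg p hp q hq).symm
  rintro p hp (h | h | h | h)
  · exact (eq_of_lt_of_image_agree hfg hlow p hp h).symm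
  · exact eq_of_lt_of_image_agree hgf (fun x hx => (hlow x hx).symm) p hp h
  · exact (eq_of_le_of_image_agree hfg hf hg hhigh p hp h).symm
  · exact eq_of_le_of_image_agree hgf hg hf (fun x hx => (hhigh x hx).symm) p hp h

/-- `f` and `g` induce the same order on each of the three blocks of positions
`[0, i)`, `[i, i + m)` and `[i + m, N)`. -/
def SameBlockOrder (N i m : ℕ) (f g : ℕ → ℕ) : Prop :=
  (∀ p q : ℕ, p < i → q < i → (f p < f q ↔ g p < g q)) ∧
    (∀ p q : ℕ, i ≤ p → p < i + m → i ≤ q → q < i + m → (f p < f q ↔ g p < g q)) ∧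
    (∀ p q : ℕ, i + m ≤ p → p < N → i + m ≤ q → q < N → (f p < f q ↔ g p < g q))

theorem add_eq_of_image_eq_Icc {N i m a b : ℕ} (hm : 1 ≤ m) (β : Equiv.Perm (Fin N))
    (h : pv β '' {p | i ≤ p ∧ p < i + m} = Set.Icc a b) : a + m = b + 1 := by
  have hcard := congrArg Set.ncard h
  rw [Set.ncard_image_of_injective _ (pv_injective β)] at hcard
  change (Set.Ico i (i + m)).ncard = _ at hcard
  simp only [Set.ncard_eq_toFinset_card', Set.toFinset_Ico, Set.toFinset_Icc, Nat.card_Ico,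
    Nat.card_Icc] at hcard
  omega

section Blocks

variable {N i m u v n₁ n₃ : ℕ} {ρ β : Equiv.Perm (Fin N)}

/-- Gathering the middle block into an interval decreases a permutation in the weak order. -/
theorem wle_of_gathered (hiN : i + m ≤ N) (huv : u + n₁ + m = v - n₃ + 1) (hm : 2 ≤ m)
    (hord : SameBlockOrder N i m (pv β) (pv ρ))
    (hmid : ∀ p, i ≤ p → p < i + m → u ≤ pv ρ p ∧ pv ρ p ≤ v)
    (h1 : pv β '' {p | p < i} = {x ∈ pv ρ '' {p | p < i} | x < u} ∪ Set.Ico u (u + n₁) ∪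
      {x ∈ pv ρ '' {p | p < i} | v < x})
    (h2 : pv β '' {p | i ≤ p ∧ p < i + m} = Set.Icc (u + n₁) (v - n₃))
    (h3 : pv β '' {p | i + m ≤ p ∧ p < N} = {x ∈ pv ρ '' {p | i + m ≤ p ∧ p < N} | x < u} ∪
      Set.Ioc (v - n₃) v ∪ {x ∈ pv ρ '' {p | i + m ≤ p ∧ p < N} | v < x}) :
    wle β ρ := by
  obtain ⟨ho1, ho2, ho3⟩ := hord
  have hlt : ∀ (ξ : Equiv.Perm (Fin N)), ∀ p < N, pv ξ p < N := fun ξ p hp => pv_lt ξ hp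
  have e1 := eq_of_image_agree_outside (P := {p | p < i}) (f := pv β) (g := pv ρ)
    (fun p hp q hq => ho1 p q hp hq) (a := u) (b := v + 1) (M := N)
    (fun p hp => hlt β p (lt_of_lt_of_le hp (by omega)))
    (fun p hp => hlt ρ p (lt_of_lt_of_le hp (by omega)))
    (by
      intro x hx
      rw [h1]
      simp only [Set.mem_union, Set.mem_sep_iff, Set.mem_Ico]
      constructor
      · rintro ((h | h) | h)
        exacts [h.1, by omega, h.1]
      · exact fun h => Or.inl (Or.inl ⟨h, hx⟩))
    (by
      intro x hx
      rw [h1]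
      simp only [Set.mem_union, Set.mem_sep_iff, Set.mem_Ico]
      constructor
      · rintro ((h | h) | h)
        exacts [h.1, by omega, h.1]
      · exact fun h => Or.inr ⟨h, hx⟩)
  have e3 := eq_of_image_agree_outside (P := {p | i + m ≤ p ∧ p < N}) (f := pv β) (g := pv ρ)
    (fun p hp q hq => ho3 p q hp.1 hp.2 hq.1 hq.2) (a := u) (b := v + 1) (M := N)
    (fun p hp => hlt β p hp.2) (fun p hp => hlt ρ p hp.2)
    (by
      intro x hx
      rw [h3]
      simp only [Set.mem_union, Set.mem_sep_iff, Set.mem_Ioc]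
      constructor
      · rintro ((h | h) | h)
        exacts [h.1, by omega, h.1]
      · exact fun h => Or.inl (Or.inl ⟨h, hx⟩))
    (by
      intro x hx
      rw [h3]
      simp only [Set.mem_union, Set.mem_sep_iff, Set.mem_Ioc]
      constructor
      · rintro ((h | h) | h)
        exacts [h.1, by omega, h.1]
      · exact fun h => Or.inr ⟨h, hx⟩)
  have c1 : ∀ p < i, pv β p < u ∨ (u ≤ pv β p ∧ pv β p < u + n₁) ∨ v < pv β p := by
    intro p hp
    rcases h1.subset ⟨p, hp, rfl⟩ with (h | h) | h
    exacts [Or.inl h.2, Or.inr (Or.inl h), Or.inr (Or.inr h.2)]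
  have c2 : ∀ p, i ≤ p → p < i + m → u + n₁ ≤ pv β p ∧ pv β p ≤ v - n₃ :=
    fun p hp hp' => h2.subset ⟨p, ⟨hp, hp'⟩, rfl⟩
  have c3 : ∀ p, i + m ≤ p → p < N →
      pv β p < u ∨ (v - n₃ < pv β p ∧ pv β p ≤ v) ∨ v < pv β p := by
    intro p hp hp'
    rcases h3.subset ⟨p, ⟨hp, hp'⟩, rfl⟩ with (h | h) | h
    exacts [Or.inl h.2, Or.inr (Or.inl h), Or.inr (Or.inr h.2)]
  rw [wle_iff_pv]
  intro p q hpq hq hinv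
  rcases lt_or_ge q i with hqi | hqi
  · exact (ho1 q p hqi (by omega)).1 hinv
  rcases lt_or_ge q (i + m) with hqm | hqm
  · rcases lt_or_ge p i with hpi | hpi
    · have := c1 p hpi
      have := e1 p hpi
      have := c2 q hqi hqm
      have := hmid q hqi hqm
      omega
    · exact (ho2 q p hqi hqm hpi (by omega)).1 hinv
  · have := c3 q hqm hq
    have := e3 q ⟨hqm, hq⟩
    rcases lt_or_ge p i with hpi | hpi
    · have := c1 p hpi
      have := e1 p hpi
      omega
    rcases lt_or_ge p (i + m) with hpm | hpm
    · have := c2 p hpi hpm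
      have := hmid p hpi hpm
      omega
    · exact (ho3 q p hqm hq hpm (by omega)).1 hinv

/-- Spreading the middle block as far as possible, over the values `[w - k, w + m - 1 + l]` with
`w = u + n₁`, increases a permutation in the weak order. -/
theorem wle_of_spread {w k l : ℕ} {θ : Equiv.Perm (Fin N)} (hiN : i + m ≤ N) (hm : 2 ≤ m)
    (hw : w = u + n₁) (hv : v = w + m - 1 + n₃)
    (hord : SameBlockOrder N i m (pv θ) (pv ρ))
    (hmid : ∀ p, i ≤ p → p < i + m → u ≤ pv ρ p ∧ pv ρ p ≤ v)
    (hu_mem : ∃ p, (i ≤ p ∧ p < i + m) ∧ pv ρ p = u)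
    (hv_mem : ∃ p, (i ≤ p ∧ p < i + m) ∧ pv ρ p = v)
    (h1 : pv β '' {p | p < i} = {x ∈ pv ρ '' {p | p < i} | x < u} ∪ Set.Ico u (u + n₁) ∪
      {x ∈ pv ρ '' {p | p < i} | v < x})
    (h3 : pv β '' {p | i + m ≤ p ∧ p < N} = {x ∈ pv ρ '' {p | i + m ≤ p ∧ p < N} | x < u} ∪
      Set.Ioc (v - n₃) v ∪ {x ∈ pv ρ '' {p | i + m ≤ p ∧ p < N} | v < x})
    (hn₁k : n₁ ≤ k) (hkw : k ≤ w) (hn₃l : n₃ ≤ l)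
    (hk : ∀ x, w - k ≤ x → x < w → x ∈ pv β '' {p | p < i})
    (hl : ∀ x, w + m - 1 < x → x ≤ w + m - 1 + l → x ∈ pv β '' {p | i + m ≤ p ∧ p < N})
    (t1 : pv θ '' {p | p < i} = {x ∈ pv β '' {p | p < i} | x < w - k} ∪
      Set.Ico (w + m - 1 + l - k) (w + m - 1 + l) ∪ {x ∈ pv β '' {p | p < i} | w < x})
    (t2 : pv θ '' {p | i ≤ p ∧ p < i + m} = insert (w - k) (insert (w + m - 1 + l)
      (Set.Ioo (w - k + l) (w + m - 1 + l - k))))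
    (t3 : pv θ '' {p | i + m ≤ p ∧ p < N} =
      {x ∈ pv β '' {p | i + m ≤ p ∧ p < N} | x < w + m - 1} ∪ Set.Ioc (w - k) (w - k + l) ∪
        {x ∈ pv β '' {p | i + m ≤ p ∧ p < N} | w + m - 1 + l < x}) :
    wle ρ θ := by
  obtain ⟨ho1, ho2, ho3⟩ := hord
  have b1 : ∀ x, x ∈ pv β '' {p | p < i} ↔ (x ∈ pv ρ '' {p | p < i} ∧ (x < u ∨ v < x)) ∨
      (u ≤ x ∧ x < w) := by
    intro x
    rw [h1, hw]
    simp only [Set.mem_union, Set.mem_sep_iff, Set.mem_Ico]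
    tauto
  have b3 : ∀ x, x ∈ pv β '' {p | i + m ≤ p ∧ p < N} ↔
      (x ∈ pv ρ '' {p | i + m ≤ p ∧ p < N} ∧ (x < u ∨ v < x)) ∨ (w + m - 1 < x ∧ x ≤ v) := by
    intro x
    rw [h3, show v - n₃ = w + m - 1 by omega]
    simp only [Set.mem_union, Set.mem_sep_iff, Set.mem_Ioc]
    tauto
  have hlow : ∀ x, w - k ≤ x → x < u → x ∈ pv ρ '' {p | p < i} := by
    intro x hx hxu
    rcases (b1 x).1 (hk x hx (by omega)) with h | h
    exacts [h.1, by omega]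
  have hhigh : ∀ x, v < x → x ≤ w + m - 1 + l → x ∈ pv ρ '' {p | i + m ≤ p ∧ p < N} := by
    intro x hx hxl
    rcases (b3 x).1 (hl x (by omega) hxl) with h | h
    exacts [h.1, by omega]
  have gap1 : ∀ p < i, v ≤ pv ρ p → w + m - 1 + l < pv ρ p := by
    intro p hp hvp
    by_contra hcon
    rcases hvp.eq_or_lt with h | h
    · obtain ⟨q, hq, hqv⟩ := hv_mem
      have := pv_injective ρ (hqv.trans h)
      omega
    · obtain ⟨q, hq, hqp⟩ := hhigh _ h (by omega)
      have := pv_injective ρ hqp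
      have := hq.1
      omega
  have gap3 : ∀ q, i + m ≤ q → q < N → pv ρ q ≤ u → pv ρ q < w - k := by
    intro q hq hqN huq
    by_contra hcon
    rcases huq.eq_or_lt with h | h
    · obtain ⟨p, hp, hpu⟩ := hu_mem
      have := pv_injective ρ (hpu.trans h.symm)
      omega
    · obtain ⟨p, hp, hpq⟩ := hlow _ (by omega) h
      have := pv_injective ρ hpq
      have : p < i := hp
      omega
  have s1 : ∀ x, x ∈ pv θ '' {p | p < i} ↔
      (x ∈ pv ρ '' {p | p < i} ∧ (x < w - k ∨ w + m - 1 + l < x)) ∨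
        (w + m - 1 + l - k ≤ x ∧ x < w + m - 1 + l) := by
    intro x
    rw [t1]
    simp only [Set.mem_union, Set.mem_Ico, b1]
    constructor
    · rintro ((⟨h | h, h'⟩ | h) | ⟨h | h, h'⟩)
      · exact Or.inl ⟨h.1, Or.inl h'⟩
      · omega
      · exact Or.inr h
      · obtain ⟨⟨p, hp, rfl⟩, h''⟩ := h
        exact Or.inl ⟨⟨p, hp, rfl⟩, Or.inr (gap1 p hp (by omega))⟩
      · omega
    · rintro (⟨h, h' | h'⟩ | h)
      · exact Or.inl (Or.inl ⟨Or.inl ⟨h, Or.inl (by omega)⟩, h'⟩)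
      · exact Or.inr ⟨Or.inl ⟨h, Or.inr (by omega)⟩, by omega⟩
      · exact Or.inl (Or.inr h)
  have s3 : ∀ x, x ∈ pv θ '' {p | i + m ≤ p ∧ p < N} ↔
      (x ∈ pv ρ '' {p | i + m ≤ p ∧ p < N} ∧ (x < w - k ∨ w + m - 1 + l < x)) ∨
        (w - k < x ∧ x ≤ w - k + l) := by
    intro x
    rw [t3]
    simp only [Set.mem_union, Set.mem_Ioc, b3]
    constructor
    · rintro ((⟨h | h, h'⟩ | h) | ⟨h | h, h'⟩)
      · obtain ⟨⟨q, hq, rfl⟩, h''⟩ := h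
        exact Or.inl ⟨⟨q, hq, rfl⟩, Or.inl (gap3 q hq.1 hq.2 (by omega))⟩
      · omega
      · exact Or.inr h
      · exact Or.inl ⟨h.1, Or.inr h'⟩
      · omega
    · rintro (⟨h, h' | h'⟩ | h)
      · exact Or.inl (Or.inl ⟨Or.inl ⟨h, Or.inl (by omega)⟩, by omega⟩)
      · exact Or.inr ⟨Or.inl ⟨h, Or.inr (by omega)⟩, h'⟩
      · exact Or.inl (Or.inr h)
  have e1 := eq_of_image_agree_outside (P := {p | p < i}) (f := pv θ) (g := pv ρ)
    (fun p hp q hq => ho1 p q hp hq) (a := w - k) (b := w + m - 1 + l + 1) (M := N)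
    (fun p hp => pv_lt θ (lt_of_lt_of_le hp (by omega)))
    (fun p hp => pv_lt ρ (lt_of_lt_of_le hp (by omega)))
    (by
      intro x hx
      rw [s1]
      constructor
      · rintro (h | h)
        exacts [h.1, by omega]
      · exact fun h => Or.inl ⟨h, Or.inl hx⟩)
    (by
      intro x hx
      rw [s1]
      constructor
      · rintro (h | h)
        exacts [h.1, by omega]
      · exact fun h => Or.inl ⟨h, Or.inr hx⟩)
  have e3 := eq_of_image_agree_outside (P := {p | i + m ≤ p ∧ p < N}) (f := pv θ) (g := pv ρ)
    (fun p hp q hq => ho3 p q hp.1 hp.2 hq.1 hq.2) (a := w - k) (b := w + m - 1 + l + 1) (M := N)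
    (fun p hp => pv_lt θ hp.2) (fun p hp => pv_lt ρ hp.2)
    (by
      intro x hx
      rw [s3]
      constructor
      · rintro (h | h)
        exacts [h.1, by omega]
      · exact fun h => Or.inl ⟨h, Or.inl hx⟩)
    (by
      intro x hx
      rw [s3]
      constructor
      · rintro (h | h)
        exacts [h.1, by omega]
      · exact fun h => Or.inl ⟨h, Or.inr hx⟩)
  have c1 : ∀ p < i, (pv θ p < w - k ∨ w + m - 1 + l < pv θ p) ∨
      (w + m - 1 + l - k ≤ pv θ p ∧ pv θ p < w + m - 1 + l) := fun p hp =>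
    ((s1 _).1 ⟨p, hp, rfl⟩).imp_left And.right
  have c3 : ∀ p, i + m ≤ p → p < N → (pv θ p < w - k ∨ w + m - 1 + l < pv θ p) ∨
      (w - k < pv θ p ∧ pv θ p ≤ w - k + l) := fun p hp hp' =>
    ((s3 _).1 ⟨p, ⟨hp, hp'⟩, rfl⟩).imp_left And.right
  have c2 : ∀ p, i ≤ p → p < i + m → pv θ p = w - k ∨ pv θ p = w + m - 1 + l ∨
      (w - k + l < pv θ p ∧ pv θ p < w + m - 1 + l - k) :=
    fun p hp hp' => t2.subset ⟨p, ⟨hp, hp'⟩, rfl⟩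
  have max2 : ∀ p, i ≤ p → p < i + m → pv ρ p < v → pv θ p < w + m - 1 + l - k := by
    intro p hp hp' hlt
    obtain ⟨q, hq, hqv⟩ := hv_mem
    have := (ho2 p q hp hp' hq.1 hq.2).2 (by omega)
    have := c2 p hp hp'
    have := c2 q hq.1 hq.2
    omega
  have min2 : ∀ p, i ≤ p → p < i + m → u < pv ρ p → w - k + l < pv θ p := by
    intro p hp hp' hlt
    obtain ⟨q, hq, hqu⟩ := hu_mem
    have := (ho2 q p hq.1 hq.2 hp hp').2 (by omega)
    have := c2 p hp hp'
    have := c2 q hq.1 hq.2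
    omega
  rw [wle_iff_pv]
  intro p q hpq hq hinv
  rcases lt_or_ge q i with hqi | hqi
  · exact (ho1 q p hqi (by omega)).2 hinv
  rcases lt_or_ge q (i + m) with hqm | hqm
  · rcases lt_or_ge p i with hpi | hpi
    · have := c1 p hpi
      have := e1 p hpi
      have := gap1 p hpi
      have := c2 q hqi hqm
      have := max2 q hqi hqm
      have := hmid q hqi hqm
      omega
    · exact (ho2 q p hqi hqm hpi (by omega)).2 hinv
  · have := c3 q hqm hq
    have := e3 q ⟨hqm, hq⟩
    have := gap3 q hqm hq
    rcases lt_or_ge p i with hpi | hpi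
    · have := c1 p hpi
      have := e1 p hpi
      have := gap1 p hpi
      omega
    rcases lt_or_ge p (i + m) with hpm | hpm
    · have := c2 p hpi hpm
      have := min2 p hpi hpm
      have := hmid p hpi hpm
      omega
    · exact (ho3 q p hqm hq hpm (by omega)).2 hinv

end Blocks

/-- With a middle block of length one, `B_i ∘ P_i` and `T_i ∘ P_i` are the identity. -/
theorem eq_of_IsP_one {n i : ℕ} {ρ ρB ρT : Equiv.Perm (Fin (n + 1 - 1))}
    {σ : Equiv.Perm (Fin n)} {τ : Equiv.Perm (Fin 1)}
    (hP : IsP i ρ σ τ) (hB : IsB i σ τ ρB) (hT : IsT i σ τ ρT) :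
    (∀ j < n + 1 - 1, pv ρB j = pv ρ j) ∧ ∀ j, pv ρT j = pv ρ j := by
  simp only [IsP, IsT, if_true] at hP hT
  obtain ⟨hσ, -⟩ := hP
  refine ⟨fun j hj => ?_, fun j => (hT j).trans (hσ j)⟩
  have havv : ∀ s x, avv 1 s x = x := by
    intro s x
    unfold avv
    split_ifs <;> rfl
  rw [hB j hj, BFun]
  split_ifs with h1 h2
  · rw [havv, hσ]
  · obtain rfl : j = i := by omega
    have := pv_lt τ (j := 0) (by omega)
    rw [Nat.sub_self, hσ]
    omega
  · rw [havv, hσ]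
    congr 1
    omega

/-- **Theorem.** `B_i ∘ P_i ≤ Id ≤ T_i ∘ P_i`: for every `ρ ∈ S_{n+m-1}`, writing
`P_i(ρ) = (σ,τ)`, one has `B_i(σ,τ) ≤ ρ ≤ T_i(σ,τ)` in the left weak order. -/
theorem B_P_le_id_le_T_P {n m : ℕ} (hn : 1 ≤ n) (hm : 1 ≤ m) (i : ℕ) (hi : i < n)
    (ρ ρB ρT : Equiv.Perm (Fin (n + m - 1)))
    (σ : Equiv.Perm (Fin n)) (τ : Equiv.Perm (Fin m))
    (hP : IsP i ρ σ τ) (hB : IsB i σ τ ρB) (hT : IsT i σ τ ρT) :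
    wle ρB ρ ∧ wle ρ ρT := by
  obtain rfl | hm2 : m = 1 ∨ 2 ≤ m := by omega
  · obtain ⟨hBρ, hTρ⟩ := eq_of_IsP_one hP hB hT
    rw [wle_iff_pv, wle_iff_pv]
    refine ⟨fun p q hpq hq h => ?_, fun p q hpq hq h => ?_⟩
    · rwa [← hBρ q hq, ← hBρ p (hpq.trans hq)]
    · rwa [hTρ, hTρ]
  rw [IsP, if_neg (by omega)] at hP
  rw [IsT, if_neg (by omega)] at hT
  obtain ⟨β, ho1, ho2, ho3, h1, h2, h3, hσ, hτ⟩ := hP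
  obtain ⟨ht1, ht2, ht3, t1, t2, t3⟩ := hT
  obtain ⟨hmid, hu, hv⟩ := middle_block_extrema hm ρ (i := i)
  have hn₁ := ncard_Cmid1_le i m ρ
  have hn₃ := ncard_Cmid3_le i m ρ
  generalize uPar i m ρ = u at *
  generalize vPar i m ρ = v at *
  generalize (Cmid1 i m ρ).ncard = n₁ at *
  generalize (Cmid3 i m ρ).ncard = n₃ at *
  have huv := add_eq_of_image_eq_Icc hm β h2
  obtain ⟨hσi, hBF⟩ := BFun_eq_of_standardization (w := u + n₁) hm2 hi β σ τ
    (by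
      rw [h2]
      ext x
      simp only [Set.mem_Icc, Set.mem_Ico]
      omega)
    hσ
    (fun p q => (hτ p q).trans (ho2 _ _ (by omega) (by omega) (by omega) (by omega)).symm)
  have hbL1 : bL1 i σ τ = pv β '' {p | p < i} :=
    Set.image_congr fun p hp => hBF p (lt_of_lt_of_le hp (by omega))
  have hbL3 : bL3 i σ τ = pv β '' {p | i + m ≤ p ∧ p < n + m - 1} :=
    Set.image_congr fun p hp => hBF p hp.2
  constructor
  · have hlower := wle_of_gathered (by omega) huv hm2 ⟨ho1, ho2, ho3⟩ hmid h1 h2 h3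
    rw [wle_iff_pv] at hlower ⊢
    intro p q hpq hq h
    rw [hB q hq, hB p (hpq.trans hq), hBF q hq, hBF p (hpq.trans hq)] at h
    exact hlower p q hpq hq h
  · have hkspec := kpar_spec i σ τ
    have hlspec := lpar_spec i σ τ
    have hn₁k : n₁ ≤ kpar i σ τ := by
      refine le_kpar hn₁ (by omega) fun x hx hx' => ?_
      rw [hbL1, h1]
      exact Or.inl (Or.inr ⟨by omega, by omega⟩)
    have hn₃l : n₃ ≤ lpar i σ τ := by
      refine le_lpar (by omega) fun x hx hx' => ?_
      rw [hbL3, h3]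
      exact Or.inl (Or.inr ⟨by omega, by omega⟩)
    simp only [A1b, A1t, A3b, A3t, hbL1, hbL3, hσi] at t1 t2 t3 hkspec hlspec
    refine wle_of_spread (β := β) (by omega) hm2 rfl (by omega) ⟨?_, ?_, ?_⟩ hmid hu hv h1 h3
      hn₁k hkspec.1 hn₃l hkspec.2 hlspec t1 t2 t3
    · intro p q hp hq
      rw [ht1 p q hp hq, hBF p (by omega), hBF q (by omega), ho1 p q hp hq]
    · intro p q hp hp' hq hq'
      rw [ht2 p q hp hp' hq hq', hBF p (by omega), hBF q (by omega), ho2 p q hp hp' hq hq']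
    · intro p q hp hp' hq hq'
      rw [ht3 p q hp hp' hq hq', hBF p hp', hBF q hq', ho3 p q hp hp' hq hq']
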